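/- Let Ω = ℝ×(0,1). There is C > 0 such that for every u ∈ H^2(Ω;ℝ²) divergence free, with u²=0 on ∂Ω and satisfying μ∂_y u¹(x,0)=−k₀u¹(x,0), μ∂_y u¹(x,1)=k₁u¹(x,1), one has ‖u‖_{L^∞(Ω)}² ≤ C ‖u‖_{L^2(Ω)} ‖u‖_{H^2(Ω)}. -/

import Mathlib

open MeasureTheory Set

/-- The strip `Ω = ℝ × (0,1)` in `ℝ²`. -/
def strip : Set (ℝ × ℝ) := Set.univ ×ˢ Set.Ioo (0 : ℝ) 1

/-- Horizontal partial derivative. -/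
noncomputable def dx (g : ℝ × ℝ → ℝ) (q : ℝ × ℝ) : ℝ := fderiv ℝ g q (1, 0)

/-- Vertical partial derivative. -/
noncomputable def dy (g : ℝ × ℝ → ℝ) (q : ℝ × ℝ) : ℝ := fderiv ℝ g q (0, 1)

section IntervalEstimates

variable {E : Type*} [NormedAddCommGroup E] [NormedSpace ℝ E] [CompleteSpace E]

theorem norm_sub_le_integral_norm_deriv {f f' : ℝ → E} (hf : ∀ t, HasDerivAt f (f' t) t)
    (hf' : Continuous f') {a b s t : ℝ} (hs : s ∈ Icc a b) (ht : t ∈ Icc a b) :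
    ‖f s - f t‖ ≤ ∫ x in a..b, ‖f' x‖ := by
  rw [← intervalIntegral.integral_eq_sub_of_hasDerivAt (fun x _ => hf x)
    (hf'.intervalIntegrable t s)]
  refine intervalIntegral.norm_integral_le_integral_norm_uIoc.trans ?_
  rw [intervalIntegral.integral_of_le (hs.1.trans hs.2)]
  refine setIntegral_mono_set ?_ (Filter.Eventually.of_forall fun x => norm_nonneg _)
    (Filter.Eventually.of_forall ?_)
  · exact (hf'.norm.intervalIntegrable a b).1
  · exact Ioc_subset_Ioc (le_min ht.1 hs.1) (max_le ht.2 hs.2)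

theorem norm_le_average_add_integral_norm_deriv {f f' : ℝ → E}
    (hf : ∀ t, HasDerivAt f (f' t) t) (hf' : Continuous f') {a r s : ℝ} (hr : 0 < r)
    (hs : s ∈ Icc a (a + r)) :
    ‖f s‖ ≤ r⁻¹ * (∫ x in a..a + r, ‖f x‖) + ∫ x in a..a + r, ‖f' x‖ := by
  have hc : Continuous f := continuous_iff_continuousAt.2 fun t => (hf t).continuousAt
  set V := ∫ x in a..a + r, ‖f' x‖
  have h : ∫ _ in a..a + r, ‖f s‖ ≤ ∫ t in a..a + r, (‖f t‖ + V) := by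
    refine intervalIntegral.integral_mono_on (by linarith) (by simp)
      ((hc.norm.add continuous_const).intervalIntegrable _ _) fun t ht => ?_
    have h1 : ‖f s - f t‖ ≤ V := norm_sub_le_integral_norm_deriv hf hf' hs ht
    have h2 := norm_sub_norm_le (f s) (f t)
    linarith
  rw [intervalIntegral.integral_add (hc.norm.intervalIntegrable _ _) (by simp)] at h
  simp only [intervalIntegral.integral_const, add_sub_cancel_left, smul_eq_mul] at h
  refine le_of_mul_le_mul_left ?_ hr
  rw [mul_add, mul_inv_cancel_left₀ hr.ne']
  exact h

theorem norm_deriv_le_average_add_integral_norm_deriv_two {f f' f'' : ℝ → E}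
    (hf : ∀ t, HasDerivAt f (f' t) t) (hf' : ∀ t, HasDerivAt f' (f'' t) t)
    (hf'' : Continuous f'') {a r s : ℝ} (hr : 0 < r) (hs : s ∈ Icc a (a + r)) :
    ‖f' s‖ ≤ 4 * (r⁻¹ ^ 2 * ∫ x in a..a + r, ‖f x‖) + ∫ x in a..a + r, ‖f'' x‖ := by
  have hc : Continuous f := continuous_iff_continuousAt.2 fun t => (hf t).continuousAt
  set V := ∫ x in a..a + r, ‖f'' x‖
  have key : ∀ t ∈ Icc a (a + r / 2),
      r / 2 * ‖f' s‖ ≤ ‖f t‖ + ‖f (t + r / 2)‖ + r / 2 * V := by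
    intro t ht
    have h1 : ‖(f (t + r / 2) - (t + r / 2) • f' s) - (f t - t • f' s)‖
        ≤ V * (t + r / 2 - t) := by
      refine norm_image_sub_le_of_norm_deriv_le_segment' (f := fun x => f x - x • f' s)
        (f' := fun x => f' x - f' s) (fun x _ => ?_) (fun x hx => ?_) (t + r / 2)
        (right_mem_Icc.2 (by linarith))
      · simpa using ((hf x).fun_sub ((hasDerivAt_id x).smul_const (f' s))).hasDerivWithinAt
      · exact norm_sub_le_integral_norm_deriv hf' hf''
          ⟨ht.1.trans hx.1, by linarith [hx.2, ht.2]⟩ hs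
    have h2 : (r / 2) • f' s = (f (t + r / 2) - f t)
        - ((f (t + r / 2) - (t + r / 2) • f' s) - (f t - t • f' s)) := by
      rw [add_smul]; abel
    have h3 : r / 2 * ‖f' s‖ = ‖(r / 2) • f' s‖ := by
      rw [norm_smul, Real.norm_of_nonneg (by positivity)]
    rw [h3, h2]
    have h4 := norm_sub_le (f (t + r / 2) - f t)
      ((f (t + r / 2) - (t + r / 2) • f' s) - (f t - t • f' s))
    have h5 := norm_sub_le (f (t + r / 2)) (f t)
    linarith
  have hc2 : Continuous fun t => ‖f (t + r / 2)‖ := by fun_prop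
  have hc3 : Continuous fun t => ‖f t‖ + ‖f (t + r / 2)‖ := by fun_prop
  have hc4 : Continuous fun t => ‖f t‖ + ‖f (t + r / 2)‖ + r / 2 * V := by fun_prop
  have h := intervalIntegral.integral_mono_on (μ := volume) (a := a) (b := a + r / 2)
    (by linarith) (by simp) (hc4.intervalIntegrable _ _) key
  rw [intervalIntegral.integral_add (hc3.intervalIntegrable _ _) (by simp),
    intervalIntegral.integral_add (hc.norm.intervalIntegrable _ _)
      (hc2.intervalIntegrable _ _),
    intervalIntegral.integral_comp_add_right (fun t => ‖f t‖), add_assoc a, add_halves,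
    intervalIntegral.integral_add_adjacent_intervals (hc.norm.intervalIntegrable _ _)
      (hc.norm.intervalIntegrable _ _)] at h
  simp only [intervalIntegral.integral_const, add_sub_cancel_left, smul_eq_mul] at h
  have hr2 : 0 < r / 2 * (r / 2) := by positivity
  refine le_of_mul_le_mul_left ?_ hr2
  have h6 : r / 2 * (r / 2) * (4 * (r⁻¹ ^ 2 * ∫ x in a..a + r, ‖f x‖) + V)
      = (∫ x in a..a + r, ‖f x‖) + r / 2 * (r / 2 * V) := by
    field_simp
    ring
  rw [h6, mul_assoc]
  exact h

theorem integral_norm_deriv_le_add_integral_norm_deriv_two {f f' f'' : ℝ → E}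
    (hf : ∀ t, HasDerivAt f (f' t) t) (hf' : ∀ t, HasDerivAt f' (f'' t) t)
    (hf'' : Continuous f'') {a r : ℝ} (hr : 0 < r) :
    ∫ x in a..a + r, ‖f' x‖ ≤
      4 * (r⁻¹ * ∫ x in a..a + r, ‖f x‖) + r * ∫ x in a..a + r, ‖f'' x‖ := by
  have hc : Continuous f' := continuous_iff_continuousAt.2 fun t => (hf' t).continuousAt
  have h := intervalIntegral.integral_mono_on (μ := volume) (a := a) (b := a + r)
    (by linarith) (hc.norm.intervalIntegrable _ _) (by simp)
    fun t ht => norm_deriv_le_average_add_integral_norm_deriv_two hf hf' hf'' hr ht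
  rw [intervalIntegral.integral_const, add_sub_cancel_left, smul_eq_mul] at h
  refine h.trans_eq ?_
  field_simp

end IntervalEstimates

section SquareEstimates

theorem Continuous.integrableOn_Ioc_prod_Ioc {g : ℝ × ℝ → ℝ} (hg : Continuous g)
    (a b c d : ℝ) : IntegrableOn g (Ioc a b ×ˢ Ioc c d) :=
  (hg.continuousOn.integrableOn_compact (isCompact_Icc.prod isCompact_Icc)).mono_set
    (prod_mono Ioc_subset_Icc_self Ioc_subset_Icc_self)

theorem intervalIntegral_intervalIntegral_eq_setIntegral_prod {g : ℝ × ℝ → ℝ}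
    (hg : Continuous g) {a b c d : ℝ} (hab : a ≤ b) (hcd : c ≤ d) :
    ∫ x in a..b, ∫ y in c..d, g (x, y) = ∫ q in Ioc a b ×ˢ Ioc c d, g q := by
  have hi : IntegrableOn g (Ioc a b ×ˢ Ioc c d) (volume.prod volume) :=
    hg.integrableOn_Ioc_prod_Ioc a b c d
  rw [Measure.volume_eq_prod, setIntegral_prod _ hi, intervalIntegral.integral_of_le hab]
  simp_rw [intervalIntegral.integral_of_le hcd]

theorem intervalIntegral_intervalIntegral_eq_setIntegral_prod' {g : ℝ × ℝ → ℝ}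
    (hg : Continuous g) {a b c d : ℝ} (hab : a ≤ b) (hcd : c ≤ d) :
    ∫ y in c..d, ∫ x in a..b, g (x, y) = ∫ q in Ioc a b ×ˢ Ioc c d, g q := by
  rw [intervalIntegral_intervalIntegral_eq_setIntegral_prod
    (g := fun q : ℝ × ℝ => g (q.2, q.1)) (by fun_prop) hcd hab]
  have := setIntegral_prod_swap (μ := volume) (ν := volume) (Ioc a b) (Ioc c d) g
  simpa [Measure.volume_eq_prod, Prod.swap] using this

theorem sq_setIntegral_le_volume_mul {g : ℝ × ℝ → ℝ} (hg : Continuous g) {a b r : ℝ}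
    (hr : 0 < r) :
    (∫ q in Ioc a (a + r) ×ˢ Ioc b (b + r), g q) ^ 2 ≤
      r ^ 2 * ∫ q in Ioc a (a + r) ×ˢ Ioc b (b + r), g q ^ 2 := by
  set Q := Ioc a (a + r) ×ˢ Ioc b (b + r) with hQ
  have hint : ∀ h : ℝ × ℝ → ℝ, Continuous h → IntegrableOn h Q := fun h hh =>
    hh.integrableOn_Ioc_prod_Ioc _ _ _ _
  have hvol : volume.real Q = r ^ 2 := by
    rw [hQ, Measure.volume_eq_prod, measureReal_prod_prod]
    simp [Real.volume_real_Ioc, hr.le, sq]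
  set S := ∫ q in Q, g q
  have h0 : 0 ≤ ∫ q in Q, (g q - S / r ^ 2) ^ 2 := integral_nonneg fun q => sq_nonneg _
  have h1 : ∫ q in Q, (g q - S / r ^ 2) ^ 2
      = (∫ q in Q, g q ^ 2) - 2 * (S / r ^ 2) * S + r ^ 2 * (S / r ^ 2) ^ 2 := by
    have h2 : ∀ q, (g q - S / r ^ 2) ^ 2
        = g q ^ 2 - 2 * (S / r ^ 2) * g q + (S / r ^ 2) ^ 2 := fun q => by ring
    simp_rw [h2]
    rw [integral_add (hint _ (by fun_prop)) (hint _ (by fun_prop)),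
      integral_sub (hint _ (by fun_prop)) (hint _ (by fun_prop)), integral_const_mul,
      setIntegral_const, hvol, smul_eq_mul]
  rw [h1] at h0
  have h3 : (∫ q in Q, g q ^ 2) - 2 * (S / r ^ 2) * S + r ^ 2 * (S / r ^ 2) ^ 2
      = (∫ q in Q, g q ^ 2) - S ^ 2 / r ^ 2 := by
    field_simp
    ring
  rw [h3, sub_nonneg, div_le_iff₀ (by positivity)] at h0
  linarith

variable {E : Type*} [NormedAddCommGroup E] [NormedSpace ℝ E] [CompleteSpace E]

theorem norm_le_setIntegral_square {u : ℝ × ℝ → E} (hu : ContDiff ℝ 2 u) {a b r s t : ℝ}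
    (hr : 0 < r) (hs : s ∈ Icc a (a + r)) (ht : t ∈ Icc b (b + r)) :
    ‖u (s, t)‖ ≤ 9 * (r⁻¹ ^ 2 * ∫ q in Ioc a (a + r) ×ˢ Ioc b (b + r), ‖u q‖)
      + 3 * ∫ q in Ioc a (a + r) ×ˢ Ioc b (b + r), ‖fderiv ℝ (fderiv ℝ u) q‖ := by
  have hu1 : ContDiff ℝ 1 (fderiv ℝ u) := hu.fderiv_right (by norm_num)
  have hd0 : Differentiable ℝ u := hu.differentiable (by norm_num)
  have hd1 : Differentiable ℝ (fderiv ℝ u) := hu1.differentiable (by norm_num)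
  have hc0 : Continuous u := hu.continuous
  have hc1 : Continuous (fderiv ℝ u) := hu1.continuous
  have hc2 : Continuous (fderiv ℝ (fderiv ℝ u)) := hu1.continuous_fderiv (by norm_num)
  have hx : ∀ x y : ℝ, HasDerivAt (fun x : ℝ => (x, y)) ((1, 0) : ℝ × ℝ) x := fun x y =>
    (hasDerivAt_id x).prodMk (hasDerivAt_const x y)
  have hy : ∀ x y : ℝ, HasDerivAt (fun y : ℝ => (x, y)) ((0, 1) : ℝ × ℝ) y := fun x y =>
    (hasDerivAt_const y x).prodMk (hasDerivAt_id y)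
  have hux : ∀ x y, HasDerivAt (fun x => u (x, y)) (fderiv ℝ u (x, y) (1, 0)) x := fun x y =>
    (hd0 (x, y)).hasFDerivAt.comp_hasDerivAt x (hx x y)
  have huy : ∀ x y, HasDerivAt (fun y => u (x, y)) (fderiv ℝ u (x, y) (0, 1)) y := fun x y =>
    (hd0 (x, y)).hasFDerivAt.comp_hasDerivAt y (hy x y)
  have hvx : ∀ v x y, HasDerivAt (fun x => fderiv ℝ u (x, y) v)
      (fderiv ℝ (fderiv ℝ u) (x, y) (1, 0) v) x := fun v x y =>
    (ContinuousLinearMap.apply ℝ E v).hasFDerivAt.comp_hasDerivAt x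
      ((hd1 (x, y)).hasFDerivAt.comp_hasDerivAt x (hx x y))
  have hvy : ∀ v x y, HasDerivAt (fun y => fderiv ℝ u (x, y) v)
      (fderiv ℝ (fderiv ℝ u) (x, y) (0, 1) v) y := fun v x y =>
    (ContinuousLinearMap.apply ℝ E v).hasFDerivAt.comp_hasDerivAt y
      ((hd1 (x, y)).hasFDerivAt.comp_hasDerivAt y (hy x y))
  have hN : ∀ v w : ℝ × ℝ, ‖v‖ = 1 → ‖w‖ = 1 → ∀ q,
      ‖fderiv ℝ (fderiv ℝ u) q v w‖ ≤ ‖fderiv ℝ (fderiv ℝ u) q‖ := fun v w hv hw q => by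
    simpa [hv, hw] using (fderiv ℝ (fderiv ℝ u) q).le_opNorm₂ v w
  have h10 : ‖((1, 0) : ℝ × ℝ)‖ = 1 := by simp [Prod.norm_def]
  have h01 : ‖((0, 1) : ℝ × ℝ)‖ = 1 := by simp [Prod.norm_def]
  have hle : ∀ {f g : ℝ → ℝ} {c : ℝ}, Continuous f → Continuous g → (∀ x, f x ≤ g x) →
      ∫ x in c..c + r, f x ≤ ∫ x in c..c + r, g x := fun hf hg h =>
    intervalIntegral.integral_mono (by linarith) (hf.intervalIntegrable _ _)
      (hg.intervalIntegrable _ _) h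
  have hlin : ∀ {f g : ℝ → ℝ} (c k l : ℝ), Continuous f → Continuous g →
      ∫ x in c..c + r, (k * f x + l * g x)
        = k * (∫ x in c..c + r, f x) + l * ∫ x in c..c + r, g x := fun c k l hf hg => by
    rw [intervalIntegral.integral_add ((hf.const_mul _).intervalIntegrable _ _)
      ((hg.const_mul _).intervalIntegrable _ _), intervalIntegral.integral_const_mul,
      intervalIntegral.integral_const_mul]
  have hparx : ∀ {g : ℝ × ℝ → ℝ}, Continuous g →
      Continuous fun y => ∫ x in a..a + r, g (x, y) := fun hg =>
    intervalIntegral.continuous_parametric_intervalIntegral_of_continuous'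
      (f := fun y x => _) (by fun_prop) _ _
  have hpary : ∀ {g : ℝ × ℝ → ℝ}, Continuous g →
      Continuous fun x => ∫ y in b..b + r, g (x, y) := fun hg =>
    intervalIntegral.continuous_parametric_intervalIntegral_of_continuous'
      (f := fun x y => _) (by fun_prop) _ _
  have hra : a ≤ a + r := by linarith
  have hrb : b ≤ b + r := by linarith
  have hD2 : Continuous fun q => ‖fderiv ℝ (fderiv ℝ u) q‖ :=
    (continuous_norm (E := ℝ × ℝ →L[ℝ] ℝ × ℝ →L[ℝ] E)).comp hc2
  have hUy : Continuous fun q => ‖fderiv ℝ u q (0, 1)‖ := by fun_prop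
  have eU := intervalIntegral_intervalIntegral_eq_setIntegral_prod hc0.norm hra hrb
  have eU' := intervalIntegral_intervalIntegral_eq_setIntegral_prod' hc0.norm hra hrb
  have eW := intervalIntegral_intervalIntegral_eq_setIntegral_prod hD2 hra hrb
  have eW' := intervalIntegral_intervalIntegral_eq_setIntegral_prod' hD2 hra hrb
  have eV := intervalIntegral_intervalIntegral_eq_setIntegral_prod hUy hra hrb
  have eV' := intervalIntegral_intervalIntegral_eq_setIntegral_prod' hUy hra hrb
  set U := ∫ q in Ioc a (a + r) ×ˢ Ioc b (b + r), ‖u q‖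
  set W := ∫ q in Ioc a (a + r) ×ˢ Ioc b (b + r), ‖fderiv ℝ (fderiv ℝ u) q‖
  set V := ∫ q in Ioc a (a + r) ×ˢ Ioc b (b + r), ‖fderiv ℝ u q (0, 1)‖
  have h1 := norm_le_average_add_integral_norm_deriv (huy s) (by fun_prop) hr ht
  have h2 : ∫ y in b..b + r, ‖u (s, y)‖ ≤ 5 * r⁻¹ * U + r * W := by
    rw [← eU', ← eW', ← hlin _ _ _ (hparx hc0.norm) (hparx hD2)]
    refine hle (by fun_prop)
      (((hparx hc0.norm).const_mul _).add ((hparx hD2).const_mul _)) fun y => ?_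
    have i1 := norm_le_average_add_integral_norm_deriv (fun x => hux x y) (by fun_prop) hr hs
    have i2 := integral_norm_deriv_le_add_integral_norm_deriv_two (a := a)
      (fun x => hux x y) (fun x => hvx (1, 0) x y) (by fun_prop) hr
    have i3 : ∫ x in a..a + r, ‖fderiv ℝ (fderiv ℝ u) (x, y) (1, 0) (1, 0)‖
        ≤ ∫ x in a..a + r, ‖fderiv ℝ (fderiv ℝ u) (x, y)‖ :=
      hle (by fun_prop) (hD2.comp (by fun_prop)) fun x => hN _ _ h10 h10 _
    have i4 := mul_le_mul_of_nonneg_left i3 hr.le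
    linarith
  have h3 : V ≤ 4 * r⁻¹ * U + r * W := by
    rw [← eV, ← eU, ← eW, ← hlin _ _ _ (hpary hc0.norm) (hpary hD2)]
    refine hle (hpary hUy)
      (((hpary hc0.norm).const_mul _).add ((hpary hD2).const_mul _)) fun x => ?_
    have i2 := integral_norm_deriv_le_add_integral_norm_deriv_two (a := b)
      (huy x) (hvy (0, 1) x) (by fun_prop) hr
    have i3 : ∫ y in b..b + r, ‖fderiv ℝ (fderiv ℝ u) (x, y) (0, 1) (0, 1)‖
        ≤ ∫ y in b..b + r, ‖fderiv ℝ (fderiv ℝ u) (x, y)‖ :=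
      hle (by fun_prop) (hD2.comp (by fun_prop)) fun y => hN _ _ h01 h01 _
    have i4 := mul_le_mul_of_nonneg_left i3 hr.le
    linarith
  have h4 : ∫ y in b..b + r, ‖fderiv ℝ u (s, y) (0, 1)‖ ≤ r⁻¹ * V + 1 * W := by
    rw [← eV', ← eW', ← hlin _ _ _ (hparx hUy) (hparx hD2)]
    refine hle (by fun_prop)
      (((hparx hUy).const_mul _).add ((hparx hD2).const_mul _)) fun y => ?_
    have i1 := norm_le_average_add_integral_norm_deriv (fun x => hvx (0, 1) x y)
      (by fun_prop) hr hs
    have i3 : ∫ x in a..a + r, ‖fderiv ℝ (fderiv ℝ u) (x, y) (1, 0) (0, 1)‖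
        ≤ ∫ x in a..a + r, ‖fderiv ℝ (fderiv ℝ u) (x, y)‖ :=
      hle (by fun_prop) (hD2.comp (by fun_prop)) fun x => hN _ _ h10 h01 _
    linarith
  have hri : 0 ≤ r⁻¹ := by positivity
  have h5 := mul_le_mul_of_nonneg_left h2 hri
  have h6 := mul_le_mul_of_nonneg_left h3 hri
  have h7 : r⁻¹ * (r * W) = W := inv_mul_cancel_left₀ hr.ne' W
  nlinarith

theorem sq_norm_le_setIntegral_square {u : ℝ × ℝ → E} (hu : ContDiff ℝ 2 u) {a b r s t : ℝ}
    (hr : 0 < r) (hs : s ∈ Icc a (a + r)) (ht : t ∈ Icc b (b + r)) :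
    ‖u (s, t)‖ ^ 2 ≤ 162 *
      ((∫ q in Ioc a (a + r) ×ˢ Ioc b (b + r), ‖u q‖ ^ 2) / r ^ 2
      + r ^ 2 * ∫ q in Ioc a (a + r) ×ˢ Ioc b (b + r), ‖fderiv ℝ (fderiv ℝ u) q‖ ^ 2) := by
  have hu1 : ContDiff ℝ 1 (fderiv ℝ u) := hu.fderiv_right (by norm_num)
  have h := norm_le_setIntegral_square hu hr hs ht
  have hU := sq_setIntegral_le_volume_mul (a := a) (b := b) hu.continuous.norm hr
  have hW := sq_setIntegral_le_volume_mul (a := a) (b := b)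
    (hu1.continuous_fderiv (by norm_num)).norm hr
  set U := ∫ q in Ioc a (a + r) ×ˢ Ioc b (b + r), ‖u q‖
  set W := ∫ q in Ioc a (a + r) ×ˢ Ioc b (b + r), ‖fderiv ℝ (fderiv ℝ u) q‖
  set A := ∫ q in Ioc a (a + r) ×ˢ Ioc b (b + r), ‖u q‖ ^ 2
  have h1 : (r⁻¹ ^ 2 * U) ^ 2 ≤ A / r ^ 2 := by
    have : (r⁻¹ ^ 2 * U) ^ 2 = r⁻¹ ^ 4 * U ^ 2 := by ring
    rw [this]
    refine (mul_le_mul_of_nonneg_left hU (by positivity)).trans_eq ?_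
    field_simp
  have h2 := pow_le_pow_left₀ (norm_nonneg _) h 2
  nlinarith [sq_nonneg (9 * (r⁻¹ ^ 2 * U) - 3 * W), sq_nonneg W]

end SquareEstimates

theorem le_mul_sqrt_mul_sqrt_of_forall_le_div_add_mul {M K A H : ℝ} (hA : 0 ≤ A)
    (hAH : A ≤ H) (h : ∀ s ∈ Ioo (0 : ℝ) 1, M ≤ K * (A / s + s * H)) :
    M ≤ 5 / 2 * K * √A * √H := by
  rcases hA.eq_or_lt with rfl | hA'
  · have hlim : Filter.Tendsto (fun s : ℝ => K * (0 / s + s * H)) (nhdsWithin 0 (Ioi 0))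
        (nhds (K * (0 + 0 * H))) := by
      simp only [zero_div, zero_add]
      exact Continuous.tendsto' (by fun_prop) _ _ rfl |>.mono_left nhdsWithin_le_nhds
    have := ge_of_tendsto hlim (Filter.mem_of_superset (Ioo_mem_nhdsGT one_pos) h)
    simpa using this
  · have ha : 0 < √A := Real.sqrt_pos.2 hA'
    have hb : 0 < √H := Real.sqrt_pos.2 (hA'.trans_le hAH)
    have hab : √A ≤ √H := Real.sqrt_le_sqrt hAH
    refine (h (√A / (2 * √H)) ⟨by positivity, ?_⟩).trans_eq ?_
    · rw [div_lt_one (by positivity)]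
      linarith
    · have h1 : A / (√A / (2 * √H)) = 2 * √A * √H := by
        rw [div_eq_iff (by positivity)]
        field_simp
        exact (Real.sq_sqrt hA).symm
      have h2 : √A / (2 * √H) * H = √A * √H / 2 := by
        field_simp
        exact (Real.sq_sqrt (hA.trans hAH)).symm
      rw [h1, h2]
      ring

/-- Agmon-type inequality on the strip `Ω = ℝ×(0,1)` under Navier-slip boundary
conditions: `‖u‖²_{L^∞} ≤ C ‖u‖_{L²} ‖u‖_{H²}` with `C = C(μ,k₀,k₁)`. -/
theorem agmon_strip (μ k₀ k₁ : ℝ) (hμ : 0 < μ) :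
    ∃ C > 0, ∀ (u : ℝ × ℝ → ℝ × ℝ),
      ContDiff ℝ 2 u →
      (∀ p : ℝ × ℝ, dx (fun q => (u q).1) p + dy (fun q => (u q).2) p = 0) →
      (∀ x : ℝ, (u (x, 0)).2 = 0 ∧ (u (x, 1)).2 = 0) →
      (∀ x : ℝ,
        μ * dy (fun q => (u q).1) (x, 0) = -k₀ * (u (x, 0)).1 ∧
        μ * dy (fun q => (u q).1) (x, 1) = k₁ * (u (x, 1)).1) →
      IntegrableOn (fun p => ‖u p‖ ^ 2) strip →
      IntegrableOn (fun p => ‖fderiv ℝ u p‖ ^ 2) strip →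
      IntegrableOn (fun p => ‖fderiv ℝ (fderiv ℝ u) p‖ ^ 2) strip →
      ∀ p ∈ strip,
        ‖u p‖ ^ 2 ≤
          C * (∫ q in strip, ‖u q‖ ^ 2) ^ ((1 : ℝ) / 2) *
            ((∫ q in strip, ‖u q‖ ^ 2) + (∫ q in strip, ‖fderiv ℝ u q‖ ^ 2) +
              (∫ q in strip, ‖fderiv ℝ (fderiv ℝ u) q‖ ^ 2)) ^ ((1 : ℝ) / 2) := by
  refine ⟨405, by norm_num, fun u hu _ _ _ hA _ hD p hp => ?_⟩
  obtain ⟨x, y⟩ := p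
  obtain ⟨hy0, hy1⟩ : 0 < y ∧ y < 1 := by simpa [strip] using hp
  have hB : 0 ≤ ∫ q in strip, ‖fderiv ℝ u q‖ ^ 2 := integral_nonneg fun q => sq_nonneg _
  have hD0 : 0 ≤ ∫ q in strip, ‖fderiv ℝ (fderiv ℝ u) q‖ ^ 2 :=
    integral_nonneg fun q => sq_nonneg _
  rw [← Real.sqrt_eq_rpow, ← Real.sqrt_eq_rpow]
  rw [show (405 : ℝ) = 5 / 2 * 162 by norm_num]
  refine le_mul_sqrt_mul_sqrt_of_forall_le_div_add_mul
    (integral_nonneg fun q => sq_nonneg _) (by linarith) fun s hs => ?_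
  have hr : 0 < √s := Real.sqrt_pos.2 hs.1
  have hr1 : √s < 1 := by
    rw [Real.sqrt_lt' one_pos]
    simpa using hs.2
  set r := √s
  have hrs : r ^ 2 = s := Real.sq_sqrt hs.1.le
  have hsub : Ioc x (x + r) ×ˢ Ioc (y * (1 - r)) (y * (1 - r) + r) ⊆ strip := by
    refine prod_mono (subset_univ _) fun t ht => ⟨?_, ?_⟩
    · exact (mul_pos hy0 (by linarith)).trans ht.1
    · nlinarith [ht.2]
  have h := sq_norm_le_setIntegral_square (a := x) (b := y * (1 - r)) (s := x) (t := y) hu hr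
    ⟨le_rfl, by linarith⟩ ⟨by nlinarith, by nlinarith⟩
  rw [hrs] at h
  have h0 := hs.1
  have hA0 : 0 ≤ ∫ q in strip, ‖u q‖ ^ 2 := integral_nonneg fun q => sq_nonneg _
  have hAr := setIntegral_mono_set hA (Filter.Eventually.of_forall fun q => sq_nonneg _)
    hsub.eventuallyLE
  have hDr := (setIntegral_mono_set hD (Filter.Eventually.of_forall fun q => sq_nonneg _)
    hsub.eventuallyLE).trans (le_add_of_nonneg_left (add_nonneg hA0 hB))
  exact h.trans (mul_le_mul_of_nonneg_left (add_le_add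
    (div_le_div_of_nonneg_right hAr h0.le) (mul_le_mul_of_nonneg_left hDr h0.le)) (by norm_num))
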